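/- Let S ⊂ ℤ_{≥0}^r be a good semigroup whose associated weight function satisfies w(m) = 2 − m(S) ≤ −1 (i.e., the multiplicity m(S) = |m| ≥ 3, where m is the minimal nonzero element of S). If p is a local minimum point of w with w(p) = 0, then p = 0 or p = c (the conductor). -/

import Mathlib

open Finset

/-- Lattice points (we work in `ℤ^r`; nonnegativity is imposed via hypotheses). -/
abbrev Pt (r : ℕ) := Fin r → ℤ

/-- The `i`-th standard basis vector. -/
def E {r : ℕ} (i : Fin r) : Pt r := Pi.single i 1

/-- `e_K = ∑_{i ∈ K} e_i`. -/
def eK {r : ℕ} (K : Finset (Fin r)) : Pt r := ∑ i ∈ K, E i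

/-- `Δ̄ᵢ(ℓ) = {s ∈ S : sᵢ = ℓᵢ, sⱼ ≥ ℓⱼ ∀ j ≠ i}`. -/
def DeltaBarI {r : ℕ} (S : Set (Pt r)) (ℓ : Pt r) (i : Fin r) : Set (Pt r) :=
  {s | s ∈ S ∧ s i = ℓ i ∧ ∀ j, j ≠ i → ℓ j ≤ s j}

/-- `Δᵢ(ℓ) = {s ∈ S : sᵢ = ℓᵢ, sⱼ > ℓⱼ ∀ j ≠ i}`. -/
def DeltaI {r : ℕ} (S : Set (Pt r)) (ℓ : Pt r) (i : Fin r) : Set (Pt r) :=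
  {s | s ∈ S ∧ s i = ℓ i ∧ ∀ j, j ≠ i → ℓ j < s j}

/-- `Δ(ℓ) = ∪ᵢ Δᵢ(ℓ)`. -/
def Delta {r : ℕ} (S : Set (Pt r)) (ℓ : Pt r) : Set (Pt r) := ⋃ i, DeltaI S ℓ i

/-- A good (local) semigroup `S ⊂ ℤ_{≥0}^r` with conductor `c`. -/
structure GoodSemigroup (r : ℕ) where
  S : Set (Pt r)
  c : Pt r
  nonneg : ∀ s ∈ S, (0 : Pt r) ≤ s
  zero_mem : (0 : Pt r) ∈ S
  add_mem : ∀ s ∈ S, ∀ t ∈ S, s + t ∈ S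
  coord_zero : ∀ s ∈ S, ∀ i, s i = 0 → s = 0
  min_mem : ∀ s ∈ S, ∀ t ∈ S, s ⊓ t ∈ S
  prop3 : ∀ s ∈ S, ∀ t ∈ S, ∀ i, s i = t i →
    ∃ u ∈ S, s ⊓ t ≤ u ∧ s i < u i ∧ ∀ j, j ≠ i → s j ≠ t j → u j = (s ⊓ t) j
  conductor_nonneg : (0 : Pt r) ≤ c
  conductor_mem : ∀ ℓ : Pt r, c ≤ ℓ → ℓ ∈ S
  conductor_min : ∀ c' : Pt r, 0 ≤ c' → (∀ ℓ, c' ≤ ℓ → ℓ ∈ S) → c ≤ c'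

/-- `h` is the (combinatorial) Hilbert function of the good semigroup `G`. -/
def IsHilbert {r : ℕ} (G : GoodSemigroup r) (h : Pt r → ℤ) : Prop :=
  h 0 = 0 ∧ ∀ ℓ : Pt r, 0 ≤ ℓ → ∀ i : Fin r,
    (h (ℓ + E i) = h ℓ + 1 ↔ (DeltaBarI G.S ℓ i).Nonempty) ∧
    (h (ℓ + E i) = h ℓ ↔ ¬ (DeltaBarI G.S ℓ i).Nonempty)

/-- `w` is the weight function of the good semigroup `G` (i.e. `w(ℓ) = 2h(ℓ) − |ℓ|`),
characterized by `w(0) = 0` and the step property. -/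
def IsWeight {r : ℕ} (G : GoodSemigroup r) (w : Pt r → ℤ) : Prop :=
  w 0 = 0 ∧ ∀ ℓ : Pt r, 0 ≤ ℓ → ∀ i : Fin r,
    (w (ℓ + E i) = w ℓ + 1 ↔ (DeltaBarI G.S ℓ i).Nonempty) ∧
    (w (ℓ + E i) = w ℓ - 1 ↔ ¬ (DeltaBarI G.S ℓ i).Nonempty)

/-- Generalized local minimum point of the weight function. -/
def GLM {r : ℕ} (w : Pt r → ℤ) (p : Pt r) : Prop :=
  0 ≤ p ∧ ∀ i : Fin r, 1 ≤ p i → w p < w (p - E i)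

/-- Local minimum point of the weight function. -/
def LocMin {r : ℕ} (w : Pt r → ℤ) (p : Pt r) : Prop :=
  GLM w p ∧ ∀ i : Fin r, w p < w (p + E i)

/-- Induction over the lattice points of the box `[0, b]`, along unit steps. -/
theorem box_induction {r : ℕ} {b : Pt r} {P : Pt r → Prop} (h0 : P 0)
    (hs : ∀ ℓ : Pt r, 0 ≤ ℓ → ∀ i, ℓ + E i ≤ b → P ℓ → P (ℓ + E i)) :
    ∀ ℓ : Pt r, 0 ≤ ℓ → ℓ ≤ b → P ℓ := by
  suffices H : ∀ n : ℕ, ∀ ℓ : Pt r, 0 ≤ ℓ → ℓ ≤ b → ∑ i, ℓ i = n → P ℓ by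
    intro ℓ hℓ hb
    have hn : 0 ≤ ∑ i, ℓ i := Finset.sum_nonneg fun i _ => hℓ i
    exact H (∑ i, ℓ i).toNat ℓ hℓ hb (by omega)
  intro n
  induction n with
  | zero =>
    intro ℓ hℓ _ hn
    have h : ℓ = 0 := by
      funext i
      exact (Finset.sum_eq_zero_iff_of_nonneg fun i _ => hℓ i).1 (by simpa using hn) i
        (Finset.mem_univ i)
    exact h ▸ h0
  | succ n ih =>
    intro ℓ hℓ hb hn
    obtain ⟨i, hi⟩ : ∃ i, 0 < ℓ i := by
      by_contra! hcon
      have : ∑ i, ℓ i ≤ 0 := Finset.sum_nonpos fun i _ => hcon i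
      push_cast at hn
      omega
    have hpos : 0 ≤ ℓ - E i := by
      intro j
      have := hℓ j
      by_cases hj : j = i
      · subst hj; simp [E]; omega
      · simpa [E, hj] using this
    have hle : ℓ - E i ≤ b := by
      intro j
      have : ℓ j ≤ b j := hb j
      by_cases hj : j = i
      · subst hj; simp [E]; omega
      · simpa [E, hj] using this
    have hsum : ∑ j, (ℓ - E i) j = n := by
      simp [E, Finset.sum_sub_distrib, hn]
    have := hs (ℓ - E i) hpos i (by simpa using hb) (ih _ hpos hle hsum)
    simpa using this

/-- `Δ̄ᵢ` is compatible with addition in `S`. -/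
theorem deltaBarI_add {r : ℕ} (G : GoodSemigroup r) {a b : Pt r} {i : Fin r}
    (ha : (DeltaBarI G.S a i).Nonempty) (hb : (DeltaBarI G.S b i).Nonempty) :
    (DeltaBarI G.S (a + b) i).Nonempty := by
  obtain ⟨s, hs, hsi, hsj⟩ := ha
  obtain ⟨t, ht, hti, htj⟩ := hb
  refine ⟨s + t, G.add_mem s hs t ht, by simp [hsi, hti], fun j hj => ?_⟩
  exact add_le_add (hsj j hj) (htj j hj)

/-- An element of `S` lies in each of its own `Δ̄ᵢ`. -/
theorem deltaBarI_self {r : ℕ} {G : GoodSemigroup r} {s : Pt r} (hs : s ∈ G.S) (i : Fin r) :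
    (DeltaBarI G.S s i).Nonempty :=
  ⟨s, hs, rfl, fun _ _ => le_rfl⟩

/-- A point all of whose `Δ̄ᵢ` are nonempty belongs to `S`. -/
theorem mem_of_deltaBarI_nonempty {r : ℕ} (G : GoodSemigroup r) {q : Pt r}
    (h : ∀ i, (DeltaBarI G.S q i).Nonempty) : q ∈ G.S := by
  have key : ∀ K : Finset (Fin r), ∃ s ∈ G.S, q ≤ s ∧ ∀ i ∈ K, s i = q i := by
    intro K
    induction K using Finset.induction_on with
    | empty => exact ⟨G.c ⊔ q, G.conductor_mem _ le_sup_left, le_sup_right, by simp⟩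
    | insert a K _ ih =>
      obtain ⟨s, hs, hqs, hsK⟩ := ih
      obtain ⟨t, ht, hta, htj⟩ := h a
      have hqt : q ≤ t := fun j => by
        by_cases hj : j = a
        · rw [hj, hta]
        · exact htj j hj
      refine ⟨s ⊓ t, G.min_mem s hs t ht, le_inf hqs hqt, fun i hi => ?_⟩
      have h1 := hqs i
      have h2 := hqt i
      rw [Pi.inf_apply]
      rcases Finset.mem_insert.1 hi with rfl | hi
      · rw [hta]; exact min_eq_right h1
      · rw [hsK i hi]; exact min_eq_left h2
  obtain ⟨s, hs, _, h⟩ := key Finset.univ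
  have : s = q := funext fun i => h i (Finset.mem_univ i)
  exact this ▸ hs

/-- Exchange property: moving one unit from the `j`-th to the `i`-th coordinate. -/
theorem deltaBarI_exchange {r : ℕ} (G : GoodSemigroup r) {q : Pt r} {i j : Fin r} (hij : j ≠ i)
    (h1 : (DeltaBarI G.S (q - E j) i).Nonempty)
    (h2 : (DeltaBarI G.S (q - E j + E i) j).Nonempty) :
    (DeltaBarI G.S q i).Nonempty := by
  obtain ⟨s, hs, hsi, hsk⟩ := h1
  obtain ⟨t, ht, htj, htk⟩ := h2
  have e1 : s i = q i := by simpa [E, hij.symm] using hsi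
  have e2 : q j - 1 ≤ s j := by simpa [E] using hsk j hij
  have e3 : ∀ k, k ≠ i → k ≠ j → q k ≤ s k := fun k hki hkj => by
    simpa [E, hkj] using hsk k hki
  have f1 : t j = q j - 1 := by simpa [E, hij] using htj
  have f2 : q i + 1 ≤ t i := by simpa [E, hij.symm] using htk i hij.symm
  have f3 : ∀ k, k ≠ i → k ≠ j → q k ≤ t k := fun k hki hkj => by
    simpa [E, hkj, hki] using htk k hkj
  by_cases hc : q j ≤ s j
  · refine ⟨s, hs, e1, fun k hk => ?_⟩
    by_cases hkj : k = j
    · exact hkj ▸ hc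
    · exact e3 k hk hkj
  · obtain ⟨u, hu, hle, hlt, heq⟩ := G.prop3 s hs t ht j (by omega)
    refine ⟨u, hu, ?_, fun k hk => ?_⟩
    · rw [heq i hij.symm (by omega), Pi.inf_apply, e1]
      exact min_eq_left (by omega)
    · by_cases hkj : k = j
      · subst hkj; omega
      · exact (le_inf (e3 k hk hkj) (f3 k hk hkj)).trans (hle k)

/-- Each unit step changes the weight by `1`, with sign given by nonemptiness of `Δ̄ᵢ`. -/
theorem IsWeight.step {r : ℕ} {G : GoodSemigroup r} {w : Pt r → ℤ} (hw : IsWeight G w)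
    {ℓ : Pt r} (hℓ : 0 ≤ ℓ) (i : Fin r) :
    ((DeltaBarI G.S ℓ i).Nonempty ∧ w (ℓ + E i) = w ℓ + 1) ∨
      (¬ (DeltaBarI G.S ℓ i).Nonempty ∧ w (ℓ + E i) = w ℓ - 1) := by
  by_cases h : (DeltaBarI G.S ℓ i).Nonempty
  · exact Or.inl ⟨h, (hw.2 ℓ hℓ i).1.2 h⟩
  · exact Or.inr ⟨h, (hw.2 ℓ hℓ i).2.2 h⟩

theorem E_nonneg {r : ℕ} (i : Fin r) : (0 : Pt r) ≤ E i :=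
  Pi.single_nonneg.2 zero_le_one

/-- No element of `S` obstructs a generalized local minimum from below. -/
theorem GLM.deltaBarI_sub_empty {r : ℕ} {G : GoodSemigroup r} {w : Pt r → ℤ}
    (hw : IsWeight G w) {p : Pt r} (hp : GLM w p) {i : Fin r} (hi : 1 ≤ p i) :
    ¬ (DeltaBarI G.S (p - E i) i).Nonempty := by
  have h0 : 0 ≤ p - E i := fun j => by
    have := hp.1 j
    by_cases hj : j = i
    · subst hj; simp [E]; omega
    · simpa [E, hj] using this
  have h := hp.2 i hi
  have hs := hw.step h0 i
  rw [sub_add_cancel] at hs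
  rcases hs with ⟨_, h'⟩ | ⟨h', _⟩
  · omega
  · exact h'

/-- The weight function is symmetric on `[0, p]` for a generalized local minimum `p` of
weight zero. -/
theorem GLM.weight_symm {r : ℕ} {G : GoodSemigroup r} {w : Pt r → ℤ}
    (hw : IsWeight G w) {p : Pt r} (hp : GLM w p) (hp0 : w p = 0) {ℓ : Pt r}
    (h0 : 0 ≤ ℓ) (hle : ℓ ≤ p) : w (p - ℓ) = w ℓ := by
  have key : ∀ ℓ : Pt r, 0 ≤ ℓ → ℓ ≤ p → w ℓ ≤ w (p - ℓ) := by
    apply box_induction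
    · simp [hw.1, hp0]
    · intro ℓ hℓ i hi ih
      have h1 := hw.step hℓ i
      have h2 := hw.step (sub_nonneg.2 hi) i
      rw [show p - (ℓ + E i) + E i = p - ℓ by abel] at h2
      have hpi : 1 ≤ p i := by
        have a := hi i
        have b := hℓ i
        simp [E] at a b
        omega
      have h3 : ¬ ((DeltaBarI G.S ℓ i).Nonempty ∧
          (DeltaBarI G.S (p - (ℓ + E i)) i).Nonempty) := fun ⟨a, b⟩ => by
        apply hp.deltaBarI_sub_empty hw hpi
        have := deltaBarI_add G a b
        rwa [show ℓ + (p - (ℓ + E i)) = p - E i by abel] at this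
      rcases h1 with ⟨a, h1⟩ | ⟨_, h1⟩ <;> rcases h2 with ⟨b, h2⟩ | ⟨_, h2⟩
      · exact absurd ⟨a, b⟩ h3
      all_goals omega
  apply le_antisymm _ (key ℓ h0 hle)
  simpa using key (p - ℓ) (sub_nonneg.2 hle) (sub_le_self p h0)

/-- In the situation of `GLM.weight_symm`, emptiness of `Δ̄ᵢ` reflects to nonemptiness. -/
theorem GLM.deltaBarI_reflect {r : ℕ} {G : GoodSemigroup r} {w : Pt r → ℤ}
    (hw : IsWeight G w) {p : Pt r} (hp : GLM w p) (hp0 : w p = 0) {ℓ : Pt r} {i : Fin r}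
    (h0 : 0 ≤ ℓ) (hle : ℓ + E i ≤ p) (h : ¬ (DeltaBarI G.S ℓ i).Nonempty) :
    (DeltaBarI G.S (p - (ℓ + E i)) i).Nonempty := by
  have h1 := hw.step h0 i
  have h2 := hw.step (sub_nonneg.2 hle) i
  rw [show p - (ℓ + E i) + E i = p - ℓ by abel] at h2
  have h3 := hp.weight_symm hw hp0 h0 ((le_add_of_nonneg_right (E_nonneg i)).trans hle)
  have h4 := hp.weight_symm hw hp0 (add_nonneg h0 (E_nonneg i)) hle
  rcases h1 with ⟨a, _⟩ | ⟨_, h1⟩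
  · exact absurd a h
  · rcases h2 with ⟨b, _⟩ | ⟨_, h2⟩
    · exact b
    · omega

/-- If `Δ̄ᵢ(ℓ)` is nonempty and `ℓᵢ < mᵢ`, where `m` is below all nonzero elements, then
`ℓ ≤ 0`. -/
theorem le_zero_of_deltaBarI_lt {r : ℕ} {G : GoodSemigroup r} {m : Pt r}
    (hmmin : ∀ s ∈ G.S, s ≠ 0 → m ≤ s) {ℓ : Pt r} {i : Fin r} (hi : ℓ i < m i)
    (h : (DeltaBarI G.S ℓ i).Nonempty) : ℓ ≤ 0 := by
  obtain ⟨s, hs, hsi, hsj⟩ := h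
  have hs0 : s = 0 := by
    by_contra hne
    have : m i ≤ s i := hmmin s hs hne i
    omega
  subst hs0
  intro j
  by_cases hj : j = i
  · rw [hj, ← hsi]
  · exact hsj j hj

/-- `w(m) ≤ 2 - |m|`. -/
theorem weight_multiplicity_le {r : ℕ} {G : GoodSemigroup r} {w : Pt r → ℤ}
    (hw : IsWeight G w) {m : Pt r} (hm : m ∈ G.S) (hmmin : ∀ s ∈ G.S, s ≠ 0 → m ≤ s) :
    w m ≤ 2 - ∑ i, m i := by
  refine box_induction (b := m) (P := fun ℓ => w ℓ ≤ 2 - ∑ i, ℓ i) ?_ ?_ m (G.nonneg m hm) le_rfl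
  · simp [hw.1]
  · intro ℓ hℓ i hi ih
    have hsum : ∑ j, (ℓ + E i) j = ∑ j, ℓ j + 1 := by
      simp [E, Finset.sum_add_distrib]
    rw [hsum]
    rcases hw.step hℓ i with ⟨a, h⟩ | ⟨_, h⟩
    · have hlt : ℓ i < m i := by
        have := hi i
        simp [E] at this
        omega
      have hz : ℓ = 0 := le_antisymm (le_zero_of_deltaBarI_lt hmmin hlt a) hℓ
      subst hz
      rw [h, hw.1]
      simp
    · omega

/-- A pair `(q, i)` with `q ≥ p` and `Δ̄ᵢ(q) = ∅` of minimal `|q|` satisfies `qᵢ < pᵢ + mᵢ`. -/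
theorem lt_add_of_minimal_empty {r : ℕ} {G : GoodSemigroup r} {m p q : Pt r} {i : Fin r}
    (hm : m ∈ G.S) (hmpos : ∀ j, 0 < m j) (hpq : p ≤ q)
    (hq : ¬ (DeltaBarI G.S q i).Nonempty)
    (hmin : ∀ q' : Pt r, ∀ k, p ≤ q' → ∑ j, q' j < ∑ j, q j → (DeltaBarI G.S q' k).Nonempty) :
    q i < p i + m i := by
  by_contra! hcon
  have hlt : ∑ j, ((q - m) ⊔ p) j < ∑ j, q j := by
    apply Finset.sum_lt_sum
    · intro j _
      have := hmpos j
      have : p j ≤ q j := hpq j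
      simp only [Pi.sup_apply, Pi.sub_apply, sup_le_iff]
      omega
    · refine ⟨i, Finset.mem_univ i, ?_⟩
      have := hmpos i
      simp only [Pi.sup_apply, Pi.sub_apply, sup_lt_iff]
      omega
  obtain ⟨s, hs, hsi, hsj⟩ := hmin _ i le_sup_right hlt
  refine hq ⟨s + m, G.add_mem s hs m hm, ?_, fun j hj => ?_⟩
  · simp only [Pi.sup_apply, Pi.sub_apply] at hsi
    rw [sup_eq_left.2 (by omega)] at hsi
    rw [Pi.add_apply]
    omega
  · have h := hsj j hj
    simp only [Pi.sup_apply, Pi.sub_apply, sup_le_iff] at h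
    rw [Pi.add_apply]
    omega

/-- If a local minimum `p ≥ m` of weight zero is not above the conductor, then
`Δ̄ᵢ(p + m - eᵢ)` is empty for every `i`. -/
theorem deltaBarI_empty_of_not_conductor_le {r : ℕ} {G : GoodSemigroup r} {w : Pt r → ℤ}
    (hw : IsWeight G w) {m p : Pt r} (hm : m ∈ G.S) (hmpos : ∀ j, 0 < m j)
    (hmmin : ∀ s ∈ G.S, s ≠ 0 → m ≤ s) (hp : GLM w p) (hp0 : w p = 0) (hmp : m ≤ p)
    (hc : ¬ G.c ≤ p) (j : Fin r) : ¬ (DeltaBarI G.S (p + m - E j) j).Nonempty := by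
  have hex : ∃ n : ℕ, ∃ q : Pt r, ∃ i, p ≤ q ∧ ¬ (DeltaBarI G.S q i).Nonempty ∧
      ∑ k, q k = n := by
    by_contra hcon
    refine hc (G.conductor_min p hp.1 fun ℓ hℓ => mem_of_deltaBarI_nonempty G fun i => ?_)
    by_contra h
    have hn : 0 ≤ ∑ k, ℓ k := Finset.sum_nonneg fun k _ => hp.1.trans hℓ k
    exact hcon ⟨(∑ k, ℓ k).toNat, ℓ, i, hℓ, h, by omega⟩
  classical
  obtain ⟨q, i, hpq, hq, hsum⟩ := Nat.find_spec hex
  have hmin : ∀ q' : Pt r, ∀ k, p ≤ q' → ∑ j, q' j < ∑ j, q j →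
      (DeltaBarI G.S q' k).Nonempty := by
    intro q' k hq' hlt
    by_contra h
    have hn : 0 ≤ ∑ k, q' k := Finset.sum_nonneg fun k _ => hp.1.trans hq' k
    exact Nat.find_min hex (m := (∑ k, q' k).toNat) (by omega) ⟨q', k, hq', h, by omega⟩
  have hsub : ∀ k, p k < q k → p ≤ q - E k := fun k hk l => by
    have : p l ≤ q l := hpq l
    by_cases hl : l = k
    · subst hl; simp [E]; omega
    · simpa [E, hl] using this
  have hex' : ∀ k, k ≠ i → p k < q k → ¬ (DeltaBarI G.S (q - E k + E i) k).Nonempty := by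
    intro k hk hlt h
    refine hq (deltaBarI_exchange G hk (hmin _ i (hsub k hlt) ?_) h)
    simp [E, Finset.sum_sub_distrib]
  have hqi := lt_add_of_minimal_empty hm hmpos hpq hq hmin
  have hqk : ∀ k, k ≠ i → q k ≤ p k + m k := by
    intro k hk
    by_cases hlt : p k < q k
    · have := lt_add_of_minimal_empty hm hmpos
        ((hsub k hlt).trans (le_add_of_nonneg_right (E_nonneg i))) (hex' k hk hlt)
        (by simpa [E, Finset.sum_sub_distrib, Finset.sum_add_distrib] using hmin)
      simp [E, hk] at this
      omega
    · have := hmpos k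
      omega
  have hle : q - m + E i ≤ p := fun k => by
    by_cases hk : k = i
    · subst hk; simp [E]; omega
    · have := hqk k hk
      simp [E, hk]; omega
  have hempty : ¬ (DeltaBarI G.S (q - m) i).Nonempty := fun h => by
    have := deltaBarI_add G h (deltaBarI_self hm i)
    rw [sub_add_cancel] at this
    exact hq this
  have hrefl := hp.deltaBarI_reflect hw hp0 (sub_nonneg.2 (hmp.trans hpq)) hle hempty
  have hz : p - (q - m + E i) ≤ 0 := by
    refine le_zero_of_deltaBarI_lt hmmin ?_ hrefl
    have : p i ≤ q i := hpq i
    simp [E]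
    omega
  have hqeq : q = p + m - E i := by
    have h : p = q - m + E i := le_antisymm (sub_nonpos.1 hz) hle
    rw [h]
    abel
  by_cases hj : j = i
  · rw [hj, ← hqeq]; exact hq
  · have h := hex' j hj (by
      have := hmpos j
      rw [hqeq]; simp [E, hj]; omega)
    rwa [hqeq, show p + m - E i - E j + E i = p + m - E j by abel] at h

/-- if the multiplicity `m(S) = |m| ≥ 3`, then the only local minimum
points of weight `0` are `0` and the conductor `c`. -/
theorem stmt10 {r : ℕ} (G : GoodSemigroup r) (w : Pt r → ℤ) (hw : IsWeight G w)
    (m : Pt r) (hm : m ∈ G.S) (hmne : m ≠ 0)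
    (hmmin : ∀ s ∈ G.S, s ≠ 0 → m ≤ s)
    (hmult : 3 ≤ ∑ i, m i)
    (p : Pt r) (hp : LocMin w p) (hp0 : w p = 0) :
    p = 0 ∨ p = G.c := by
  obtain ⟨hp, hup⟩ := hp
  by_cases hpz : p = 0
  · exact Or.inl hpz
  right
  have hmpos : ∀ j, 0 < m j := fun j =>
    lt_of_le_of_ne (G.nonneg m hm j) fun h => hmne (G.coord_zero m hm j h.symm)
  have hmp : m ≤ p := fun i => by
    by_contra hlt
    rcases hw.step hp.1 i with ⟨a, _⟩ | ⟨_, h⟩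
    · exact hpz (le_antisymm (le_zero_of_deltaBarI_lt hmmin (not_le.1 hlt) a) hp.1)
    · have := hup i
      omega
  have hcp : G.c ≤ p := by
    by_contra hc
    have hemp := deltaBarI_empty_of_not_conductor_le hw hm hmpos hmmin hp hp0 hmp hc
    have hadd : ∀ y : Pt r, 0 ≤ y → y ≤ p → w (y + m) = w y + w m := by
      apply box_induction
      · simp [hw.1]
      · intro y hy i hi ih
        have h1 := hw.step hy i
        have h2 := hw.step (add_nonneg hy (G.nonneg m hm)) i
        rw [add_right_comm y m (E i)] at h2
        rcases h1 with ⟨a, h1⟩ | ⟨a, h1⟩ <;> rcases h2 with ⟨b, h2⟩ | ⟨b, h2⟩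
        · omega
        · exact absurd (deltaBarI_add G a (deltaBarI_self hm i)) b
        · refine absurd ?_ (hemp i)
          have := deltaBarI_add G (hp.deltaBarI_reflect hw hp0 hy hi a) b
          rwa [show p - (y + E i) + (y + m) = p + m - E i by abel] at this
        · omega
    have h1 := hadd (p - m) (sub_nonneg.2 hmp) (sub_le_self p (G.nonneg m hm))
    rw [sub_add_cancel, hp.weight_symm hw hp0 (G.nonneg m hm) hmp] at h1
    have h2 := weight_multiplicity_le hw hm hmmin
    omega
  by_contra hne
  obtain ⟨i, hi⟩ : ∃ i, G.c i < p i := by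
    by_contra! h
    exact hne (le_antisymm h hcp)
  have hci : (0 : ℤ) ≤ G.c i := G.conductor_nonneg i
  refine hp.deltaBarI_sub_empty hw (i := i) (by omega)
    (deltaBarI_self (G.conductor_mem _ fun j => ?_) i)
  have : G.c j ≤ p j := hcp j
  by_cases hj : j = i
  · subst hj; simp [E]; omega
  · simpa [E, hj] using this
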